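/- Let I ⊆ R be a bihomogeneous ideal. If (a,b) is an admissible bidegree for I with admissible linear form h, then for every a' ≥ a the bidegree (a',b) is also admissible for I, with the same admissible linear form h. -/

import Mathlib

open MvPolynomial

noncomputable section

/-- The variables of the bigraded ring: `x₀,…,xₙ` and `y₀,…,y_m`. -/
abbrev Vars (n m : ℕ) := Fin (n+1) ⊕ Fin (m+1)

/-- The bigrading weight: `deg xᵢ = (1,0)`, `deg y_j = (0,1)`. -/
def wB (n m : ℕ) : Vars n m → ℕ × ℕ := Sum.elim (fun _ => (1, 0)) (fun _ => (0, 1))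

/-- The bigraded polynomial ring `R = k[x₀,…,xₙ,y₀,…,y_m]`. -/
abbrev BiRing (k : Type*) [Field k] (n m : ℕ) := MvPolynomial (Vars n m) k

variable (k : Type*) [Field k] (n m : ℕ)

/-- The `k`-vector space of bihomogeneous polynomials of bidegree `d`. -/
def biComponent (d : ℕ × ℕ) : Submodule k (BiRing k n m) :=
  weightedHomogeneousSubmodule k (wB n m) d

/-- An ideal is bihomogeneous if it is generated by bihomogeneous elements. -/
def IsBihomogeneous (I : Ideal (BiRing k n m)) : Prop :=
  ∃ S : Set (BiRing k n m), Ideal.span S = I ∧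
    ∀ f ∈ S, ∃ d : ℕ × ℕ, f.IsWeightedHomogeneous (wB n m) d

/-- `I` is generated in bidegrees componentwise at most `(a,b)`. -/
def GenInDegLE (I : Ideal (BiRing k n m)) (a b : ℕ) : Prop :=
  ∃ S : Set (BiRing k n m), Ideal.span S = I ∧
    ∀ f ∈ S, ∃ d : ℕ × ℕ, d.1 ≤ a ∧ d.2 ≤ b ∧ f.IsWeightedHomogeneous (wB n m) d

/-- The Hilbert function `HF_{R/I}(a,b) = dim_k (R/I)_{(a,b)}`, where `(R/I)_{(a,b)}` is the
image of the bidegree-`(a,b)` component of `R` in `R/I`. -/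
def HF (I : Ideal (BiRing k n m)) (a b : ℕ) : ℕ :=
  Module.finrank k ((biComponent k n m (a, b)).map (Ideal.Quotient.mkₐ k I).toLinearMap)

/-- `h` is an admissible linear form for `I` at bidegree `(a,b)`:  `h` has bidegree `(1,0)`,
`HF_{R/I}(a,b) = HF_{R/I}(a+1,b)` and `HF_{R/(I+⟨h⟩)}(a,b) = 0`. -/
def IsAdmissibleForm (I : Ideal (BiRing k n m)) (a b : ℕ) (h : BiRing k n m) : Prop :=
  h.IsWeightedHomogeneous (wB n m) (1, 0) ∧
  HF k n m I a b = HF k n m I (a+1) b ∧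
  HF k n m (I ⊔ Ideal.span {h}) a b = 0

/-- `(a,b)` is an admissible bidegree for `I`: `I` is generated in bidegrees `≤ (a,b)` and
there is an admissible linear form for `(a,b)`. -/
def IsAdmissible (I : Ideal (BiRing k n m)) (a b : ℕ) : Prop :=
  GenInDegLE k n m I a b ∧ ∃ h, IsAdmissibleForm k n m I a b h

namespace Adm

variable {k : Type*} [Field k] {n m : ℕ}

lemma weight_wB (e : Vars n m →₀ ℕ) :
    Finsupp.weight (wB n m) e = (∑ i, e (Sum.inl i), ∑ j, e (Sum.inr j)) := by
  rw [Finsupp.weight_apply, Finsupp.sum_fintype _ _ (by simp)]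
  rw [Fintype.sum_sum_type]
  ext <;> simp [wB, Prod.fst_sum, Prod.snd_sum]

lemma degree_eq (e : Vars n m →₀ ℕ) {a b : ℕ} (he : Finsupp.weight (wB n m) e = (a, b)) :
    Finsupp.degree e = a + b := by
  rw [weight_wB] at he
  obtain ⟨h1, h2⟩ := Prod.mk.inj he
  rw [Finsupp.degree_eq_sum, Fintype.sum_sum_type, h1, h2]

lemma finite_bi (a b : ℕ) : FiniteDimensional k (biComponent k n m (a, b)) := by
  have hfin : FiniteDimensional k (homogeneousSubmodule (Vars n m) k (a + b)) :=
    Module.Finite.iff_fg.mpr (homogeneousSubmodule_fg (σ := Vars n m) (R := k) (a + b))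
  refine Submodule.finiteDimensional_of_le
    (S₂ := homogeneousSubmodule (Vars n m) k (a + b)) ?_
  intro p hp
  rw [mem_homogeneousSubmodule]
  intro d hd
  have := degree_eq d (hp hd)
  rw [← this, Finsupp.degree_eq_weight_one]
  rfl

lemma mem_bi {d : ℕ × ℕ} {p : BiRing k n m} :
    p ∈ biComponent k n m d ↔ p.IsWeightedHomogeneous (wB n m) d := Iff.rfl

lemma bi_eq_span (d : ℕ × ℕ) : biComponent k n m d =
    Submodule.span k ((fun e => monomial e (1 : k)) '' {e | Finsupp.weight (wB n m) e = d}) := by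
  apply le_antisymm
  · intro p hp
    rw [p.as_sum]
    refine Submodule.sum_mem _ fun e he => ?_
    rw [← mul_one (coeff e p), ← smul_eq_mul, ← smul_monomial]
    exact Submodule.smul_mem _ _ (Submodule.subset_span ⟨e, hp (mem_support_iff.mp he), rfl⟩)
  · rw [Submodule.span_le]
    rintro _ ⟨e, he, rfl⟩
    exact isWeightedHomogeneous_monomial _ _ _ he

lemma exists_inl (e : Vars n m →₀ ℕ) {a b : ℕ} (he : Finsupp.weight (wB n m) e = (a + 1, b)) :
    ∃ i, e (Sum.inl i) ≠ 0 := by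
  rw [weight_wB] at he
  obtain ⟨h1, h2⟩ := Prod.mk.inj he
  by_contra! hc
  simp [hc] at h1

lemma eq_single_add (e : Vars n m →₀ ℕ) (i) (h : e (Sum.inl i) ≠ 0) :
    ∃ e', e = Finsupp.single (Sum.inl i) 1 + e' := by
  refine ⟨e - Finsupp.single (Sum.inl i) 1, (add_tsub_cancel_of_le ?_).symm⟩
  rw [Finsupp.single_le_iff]; omega

lemma weight_single_add (e : Vars n m →₀ ℕ) (i : Fin (n+1)) :
    Finsupp.weight (wB n m) (Finsupp.single (Sum.inl i) 1 + e) =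
      (1, 0) + Finsupp.weight (wB n m) e := by
  rw [map_add, Finsupp.weight_single]; simp [wB]

lemma weight_of_add (e : Vars n m →₀ ℕ) (i : Fin (n+1)) {a b : ℕ}
    (he : Finsupp.weight (wB n m) (Finsupp.single (Sum.inl i) 1 + e) = (a + 1, b)) :
    Finsupp.weight (wB n m) e = (a, b) := by
  rw [weight_single_add] at he
  have h1 := congrArg Prod.fst he
  have h2 := congrArg Prod.snd he
  simp at h1 h2
  ext <;> simp <;> omega

lemma monomial_single_add (e : Vars n m →₀ ℕ) (i : Fin (n+1)) :
    monomial (Finsupp.single (Sum.inl i) 1 + e) (1 : k) = X (Sum.inl i) * monomial e 1 := by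
  rw [X, monomial_mul, one_mul]

lemma X_mul_mem {a b : ℕ} (i : Fin (n+1)) {p : BiRing k n m}
    (hp : p ∈ biComponent k n m (a, b)) :
    X (Sum.inl i) * p ∈ biComponent k n m (a + 1, b) := by
  have := (isWeightedHomogeneous_X k (wB n m) (Sum.inl i)).mul hp
  rw [mem_bi]
  convert this using 1
  simp [wB, add_comm]

lemma h_mul_mem {a b : ℕ} {h p : BiRing k n m} (hh : h.IsWeightedHomogeneous (wB n m) (1, 0))
    (hp : p ∈ biComponent k n m (a, b)) :
    h * p ∈ biComponent k n m (a + 1, b) := by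
  have := hh.mul hp
  rw [mem_bi]
  convert this using 1
  simp [add_comm]

/-- induction for positive `x`-degree components -/
lemma bi_succ_le {a b : ℕ} (N : Submodule k (BiRing k n m))
    (H : ∀ i, ∀ p ∈ biComponent k n m (a, b), X (Sum.inl i) * p ∈ N) :
    biComponent k n m (a + 1, b) ≤ N := by
  rw [bi_eq_span, Submodule.span_le]
  rintro _ ⟨e, he, rfl⟩
  obtain ⟨i, hi⟩ := exists_inl e he
  obtain ⟨e', rfl⟩ := eq_single_add e i hi
  simp only [monomial_single_add]
  have hw := weight_of_add e' i he
  exact H i _ (isWeightedHomogeneous_monomial _ _ _ hw)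

/-- homogeneous elements of a homogeneously generated ideal -/
lemma mem_of_mem_span {S : Set (BiRing k n m)}
    (hS : ∀ f ∈ S, ∃ d : ℕ × ℕ, f.IsWeightedHomogeneous (wB n m) d)
    (d : ℕ × ℕ) (N : Submodule k (BiRing k n m))
    (H : ∀ e : Vars n m →₀ ℕ, ∀ s ∈ S, ∀ d', s.IsWeightedHomogeneous (wB n m) d' →
      Finsupp.weight (wB n m) e + d' = d → monomial e 1 * s ∈ N)
    {f : BiRing k n m} (hf : f ∈ Ideal.span S) (hfd : f ∈ biComponent k n m d) : f ∈ N := by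
  have key : weightedHomogeneousComponent (wB n m) d f ∈ N := by
    clear hfd
    refine Submodule.closure_induction
      (p := fun f _ => weightedHomogeneousComponent (wB n m) d f ∈ N) ?_ ?_ ?_ hf
    · simp
    · intro x y _ _ hx hy
      rw [map_add]; exact add_mem hx hy
    · intro r s hs
      obtain ⟨d', hd'⟩ := hS s hs
      rw [r.as_sum, Finset.sum_smul, map_sum]
      refine Submodule.sum_mem _ fun e he => ?_
      rw [← mul_one (coeff e r), ← smul_eq_mul (coeff e r), ← smul_monomial, smul_assoc, map_smul]
      refine Submodule.smul_mem _ _ ?_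
      have hm : (monomial e (1:k) * s).IsWeightedHomogeneous (wB n m)
          (Finsupp.weight (wB n m) e + d') :=
        (isWeightedHomogeneous_monomial _ _ _ rfl).mul hd'
      rw [smul_eq_mul]
      by_cases hdd : Finsupp.weight (wB n m) e + d' = d
      · rw [hdd] at hm
        rw [hm.weightedHomogeneousComponent_same]
        exact H e s hs d' hd' hdd
      · rw [hm.weightedHomogeneousComponent_ne _ (Ne.symm hdd)]
        exact zero_mem _
  rwa [IsWeightedHomogeneous.weightedHomogeneousComponent_same hfd] at key

variable (I : Ideal (BiRing k n m))

/-- graded piece of the quotient -/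
def V (a b : ℕ) : Submodule k (BiRing k n m ⧸ I) :=
  (biComponent k n m (a, b)).map (Ideal.Quotient.mkₐ k I).toLinearMap

lemma finV (a b : ℕ) : FiniteDimensional k (V I a b) := by
  have := finite_bi (k := k) (n := n) (m := m) a b
  unfold V; infer_instance

lemma HF_zero_iff (a b : ℕ) : HF k n m I a b = 0 ↔ ∀ f ∈ biComponent k n m (a, b), f ∈ I := by
  have := finV I a b
  change Module.finrank k (V I a b) = 0 ↔ _
  rw [Submodule.finrank_eq_zero, V, eq_bot_iff, Submodule.map_le_iff_le_comap]
  refine forall₂_congr fun f hf => ?_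
  simp [Ideal.Quotient.eq_zero_iff_mem]

lemma map_mul_V {a b : ℕ} {h : BiRing k n m} (hh : h.IsWeightedHomogeneous (wB n m) (1, 0))
    (hs : ∀ f ∈ biComponent k n m (a+1, b), ∃ g ∈ biComponent k n m (a, b), f - h * g ∈ I) :
    (V I a b).map (LinearMap.mulLeft k (Ideal.Quotient.mk I h)) = V I (a+1) b := by
  apply le_antisymm
  · rintro _ ⟨_, ⟨g, hg, rfl⟩, rfl⟩
    exact ⟨h * g, h_mul_mem hh hg, by simp⟩
  · rintro _ ⟨f, hf, rfl⟩
    obtain ⟨g, hg, hfg⟩ := hs f hf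
    refine ⟨_, ⟨g, hg, rfl⟩, ?_⟩
    have := Ideal.Quotient.eq.mpr hfg
    simp at this ⊢
    exact this.symm

lemma HF_eq_iff {a b : ℕ} {h : BiRing k n m} (hh : h.IsWeightedHomogeneous (wB n m) (1, 0))
    (hs : ∀ f ∈ biComponent k n m (a+1, b), ∃ g ∈ biComponent k n m (a, b), f - h * g ∈ I) :
    HF k n m I a b = HF k n m I (a+1) b ↔
      ∀ u ∈ V I a b, Ideal.Quotient.mk I h * u = 0 → u = 0 := by
  have := finV I a b
  change Module.finrank k (V I a b) = Module.finrank k (V I (a+1) b) ↔ _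
  rw [← map_mul_V I hh hs, ← LinearMap.range_domRestrict]
  set L := (LinearMap.mulLeft k (Ideal.Quotient.mk I h)).domRestrict (V I a b) with hL
  have hr := LinearMap.finrank_range_add_finrank_ker L
  have h1 : Module.finrank k (V I a b) = Module.finrank k (LinearMap.range L) ↔
      LinearMap.ker L = ⊥ := by
    rw [← Submodule.finrank_eq_zero]
    omega
  rw [h1, LinearMap.ker_eq_bot']
  constructor
  · intro H u hu h0
    exact congrArg Subtype.val (H ⟨u, hu⟩ h0)
  · rintro H ⟨u, hu⟩ h0
    exact Subtype.ext (H u hu h0)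

/-- condition `(I+h)_(a,b) = R_(a,b)` in explicit form -/
lemma step0 (hI : IsBihomogeneous k n m I) {a b : ℕ} {h : BiRing k n m}
    (hh : h.IsWeightedHomogeneous (wB n m) (1, 0))
    (h0 : ∀ f ∈ biComponent k n m (a, b), f ∈ I ⊔ Ideal.span {h})
    (f) (hf : f ∈ biComponent k n m (a, b)) :
    ∃ g, f - h * g ∈ I ∧ ∀ i, X (Sum.inl i) * g ∈ biComponent k n m (a, b) := by
  obtain ⟨S, rfl, hS⟩ := hI
  let G : Submodule k (BiRing k n m) :=
    ⨅ i : Fin (n+1), (biComponent k n m (a, b)).comap (LinearMap.mulLeft k (X (Sum.inl i)))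
  let N : Submodule k (BiRing k n m) :=
    (Ideal.span S).restrictScalars k ⊔ G.map (LinearMap.mulLeft k h)
  have hN : f ∈ N := by
    have hf' := h0 f hf
    rw [← Ideal.span_union] at hf'
    refine mem_of_mem_span (S := S ∪ {h}) ?_ (a, b) N ?_ hf' hf
    · rintro s (hs | rfl)
      · exact hS s hs
      · exact ⟨_, hh⟩
    · rintro e s (hs | rfl) d' hd' hdd
      · exact Submodule.mem_sup_left (Ideal.mul_mem_left _ _ (Ideal.subset_span hs))
      · by_cases hs0 : s = 0
        · rw [hs0, mul_zero]; exact zero_mem _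
        · have := hd'.inj_right hs0 hh
          subst this
          refine Submodule.mem_sup_right ⟨monomial e 1, ?_, by simp [mul_comm]⟩
          simp only [G, Submodule.coe_iInf, Set.mem_iInter]
          intro i
          change X (Sum.inl i) * monomial e 1 ∈ biComponent k n m (a, b)
          rw [← monomial_single_add]
          refine isWeightedHomogeneous_monomial _ _ _ ?_
          rw [weight_single_add, add_comm, hdd]
  obtain ⟨y, hy, _, ⟨g, hg, rfl⟩, rfl⟩ := Submodule.mem_sup.mp hN
  refine ⟨g, by simpa using hy, ?_⟩
  simpa [G, Submodule.mem_iInf] using hg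

lemma step1 {a b : ℕ} {h : BiRing k n m}
    (h0 : ∀ f ∈ biComponent k n m (a, b),
      ∃ g, f - h * g ∈ I ∧ ∀ i, X (Sum.inl i) * g ∈ biComponent k n m (a, b))
    (f) (hf : f ∈ biComponent k n m (a+1, b)) :
    ∃ g ∈ biComponent k n m (a, b), f - h * g ∈ I := by
  let N : Submodule k (BiRing k n m) :=
    I.restrictScalars k ⊔ (biComponent k n m (a, b)).map (LinearMap.mulLeft k h)
  have hN : f ∈ N := by
    refine bi_succ_le N ?_ hf
    intro i p hp
    obtain ⟨g, hg, hg'⟩ := h0 p hp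
    refine Submodule.mem_sup.mpr ⟨X (Sum.inl i) * (p - h * g), I.mul_mem_left _ hg, _,
      ⟨_, hg' i, rfl⟩, ?_⟩
    simp; ring
  obtain ⟨y, hy, _, ⟨g, hg, rfl⟩, rfl⟩ := Submodule.mem_sup.mp hN
  exact ⟨g, hg, by simpa using hy⟩

lemma h_mem_span {h : BiRing k n m} (hh : h.IsWeightedHomogeneous (wB n m) (1, 0)) :
    h ∈ Submodule.span k (Set.range fun i : Fin (n+1) => (X (Sum.inl i) : BiRing k n m)) := by
  have hh' : h ∈ biComponent k n m (0 + 1, 0) := hh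
  refine bi_succ_le _ ?_ hh'
  intro i p hp
  rw [bi_eq_span] at hp
  induction hp using Submodule.span_induction with
  | mem x hx =>
    obtain ⟨e, he, rfl⟩ := hx
    have hdeg := degree_eq e he
    have : e = 0 := (Finsupp.degree_eq_zero_iff e).mp (by simpa using hdeg)
    subst this
    simp only [monomial_zero', map_one, mul_one]
    exact Submodule.subset_span ⟨i, rfl⟩
  | zero => simp
  | add x y _ _ hx hy => rw [mul_add]; exact add_mem hx hy
  | smul c x _ hx => rw [mul_smul_comm]; exact Submodule.smul_mem _ _ hx

open Classical in
lemma step3 {a b : ℕ} {h : BiRing k n m}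
    (hgen : GenInDegLE k n m I a b)
    (hh : h.IsWeightedHomogeneous (wB n m) (1, 0))
    (h0 : ∀ f ∈ biComponent k n m (a, b),
      ∃ g, f - h * g ∈ I ∧ ∀ i, X (Sum.inl i) * g ∈ biComponent k n m (a, b))
    (hinj : ∀ u ∈ V I a b, Ideal.Quotient.mk I h * u = 0 → u = 0)
    (u) (hu : u ∈ V I (a+1) b) (hu0 : Ideal.Quotient.mk I h * u = 0) : u = 0 := by
  let mk := Ideal.Quotient.mk I
  have hmks : ∀ (c : k) (p : BiRing k n m), mk (c • p) = c • mk p := fun c p => rfl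
  have hV : ∀ {a b : ℕ} {p : BiRing k n m}, p ∈ biComponent k n m (a, b) → mk p ∈ V I a b :=
    fun hp => ⟨_, hp, rfl⟩
  -- left inverse of multiplication by h
  obtain ⟨θ, hθ⟩ : ∃ θ : (BiRing k n m ⧸ I) →ₗ[k] (BiRing k n m ⧸ I),
      ∀ u ∈ V I a b, θ (mk h * u) = u := by
    obtain ⟨g, hg⟩ := LinearMap.exists_leftInverse_of_injective
      ((LinearMap.mulLeft k (mk h)).domRestrict (V I a b)) (by
        rw [LinearMap.ker_eq_bot']
        rintro ⟨u, hu⟩ h0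
        exact Subtype.ext (hinj u hu h0))
    refine ⟨(V I a b).subtype ∘ₗ g, fun u hu => ?_⟩
    exact congrArg Subtype.val (LinearMap.congr_fun hg ⟨u, hu⟩)
  have hθV : ∀ p ∈ biComponent k n m (a+1, b), θ (mk p) ∈ V I a b ∧ mk h * θ (mk p) = mk p := by
    intro p hp
    obtain ⟨g, hg, hgI⟩ := step1 I h0 p hp
    have : mk p = mk h * mk g := by rw [← map_mul]; exact Ideal.Quotient.eq.mpr hgI
    rw [this, hθ _ (hV hg)]
    exact ⟨hV hg, rfl⟩
  -- commutation
  have hcomm : ∀ i j, ∀ q ∈ biComponent k n m (a, b),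
      θ (mk (X (Sum.inl i)) * θ (mk (X (Sum.inl j) * q))) =
        θ (mk (X (Sum.inl j)) * θ (mk (X (Sum.inl i) * q))) := by
    intro i j q hq
    obtain ⟨g, hgI, hg⟩ := h0 q hq
    have hq' : mk q = mk h * mk g := by rw [← map_mul]; exact Ideal.Quotient.eq.mpr hgI
    have aux : ∀ i, θ (mk (X (Sum.inl i) * q)) = mk (X (Sum.inl i)) * mk g := by
      intro i
      rw [map_mul, hq', mul_left_comm, ← map_mul, hθ _ (hV (hg i))]
    rw [aux, aux, mul_left_comm]
  let Ψ : BiRing k n m →ₗ[k] (BiRing k n m ⧸ I) :=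
    (basisMonomials (Vars n m) k).constr k fun s =>
      if hs : ∃ i : Fin (n+1), s (Sum.inl i) ≠ 0 then
        θ (mk (X (Sum.inl hs.choose)) *
          θ (mk (monomial (s - Finsupp.single (Sum.inl hs.choose) 1) 1)))
      else 0
  have hΨm : ∀ s : Vars n m →₀ ℕ, ∀ hs : ∃ i : Fin (n+1), s (Sum.inl i) ≠ 0,
      Ψ (monomial s 1) = θ (mk (X (Sum.inl hs.choose)) *
          θ (mk (monomial (s - Finsupp.single (Sum.inl hs.choose) 1) 1))) := by
    intro s hs
    have := (basisMonomials (Vars n m) k).constr_basis k (fun s =>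
      if hs : ∃ i : Fin (n+1), s (Sum.inl i) ≠ 0 then
        θ (mk (X (Sum.inl hs.choose)) *
          θ (mk (monomial (s - Finsupp.single (Sum.inl hs.choose) 1) 1)))
      else 0) s
    rw [coe_basisMonomials, dif_pos hs] at this
    exact this
  have hΨX : ∀ i, ∀ p ∈ biComponent k n m (a+1, b),
      Ψ (X (Sum.inl i) * p) = θ (mk (X (Sum.inl i)) * θ (mk p)) := by
    intro i p hp
    rw [bi_eq_span] at hp
    induction hp using Submodule.span_induction with
    | mem x hx =>
      obtain ⟨t, ht, rfl⟩ := hx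
      simp only
      rw [← monomial_single_add]
      have hs : ∃ j : Fin (n+1), (Finsupp.single (Sum.inl i) 1 + t : Vars n m →₀ ℕ) (Sum.inl j) ≠ 0 :=
        ⟨i, by simp⟩
      rw [hΨm _ hs]
      have hj := hs.choose_spec
      generalize hs.choose = j at hj ⊢
      by_cases hij : i = j
      · subst hij
        rw [add_tsub_cancel_left]
      · have htj : t (Sum.inl j) ≠ 0 := by
          simpa [Finsupp.single_apply, hij] using hj
        obtain ⟨q, rfl⟩ := eq_single_add t j htj
        rw [add_left_comm, add_tsub_cancel_left, monomial_single_add, monomial_single_add]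
        exact hcomm _ _ _ (isWeightedHomogeneous_monomial _ _ _ (weight_of_add q j ht))
    | zero => simp
    | add x y _ _ hx hy => simp only [mul_add, map_add, hx, hy]
    | smul c x _ hx => rw [mul_smul_comm, map_smul, hx, hmks, map_smul, mul_smul_comm, map_smul]
  have hΨh : ∀ p ∈ biComponent k n m (a+1, b), Ψ (h * p) = θ (mk p) := by
    intro p hp
    have : Ψ (h * p) = θ (mk h * θ (mk p)) := by
      have hs := h_mem_span hh
      generalize h = h' at hs
      induction hs using Submodule.span_induction with
      | mem x hx => obtain ⟨i, rfl⟩ := hx; exact hΨX i p hp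
      | zero => simp
      | add x y _ _ hx hy => simp only [add_mul, map_add, hx, hy]
      | smul c x _ hx => rw [smul_mul_assoc, map_smul, hx, hmks, smul_mul_assoc, map_smul]
    rw [this, (hθV p hp).2]
  obtain ⟨f, hf, rfl⟩ := hu
  change mk f = 0
  have hhf : h * f ∈ I := by
    rw [← Ideal.Quotient.eq_zero_iff_mem, map_mul]; exact hu0
  have hΨ0 : Ψ (h * f) = 0 := by
    obtain ⟨S, hSI, hS⟩ := hgen
    rw [← hSI] at hhf
    refine mem_of_mem_span (fun s hs => ?_) (a + 1 + 1, b) (LinearMap.ker Ψ) ?_ hhf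
      (h_mul_mem hh hf)
    · obtain ⟨d, _, _, hd⟩ := hS s hs
      exact ⟨d, hd⟩
    · intro e s hs d' hd' hdd
      by_cases hs0 : s = 0
      · rw [hs0, mul_zero]; exact zero_mem _
      obtain ⟨d, hda, _, hd⟩ := hS s hs
      have := hd'.inj_right hs0 hd
      subst this
      obtain ⟨w1, w2, hw⟩ : ∃ w1 w2, Finsupp.weight (wB n m) e = (w1, w2) := ⟨_, _, rfl⟩
      have hd1 := congrArg Prod.fst hdd
      rw [hw] at hd1
      simp only [Prod.fst_add] at hd1
      obtain ⟨c, rfl⟩ : ∃ c, w1 = c + 1 := ⟨w1 - 1, by omega⟩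
      obtain ⟨i, hi⟩ := exists_inl e hw
      obtain ⟨e', rfl⟩ := eq_single_add e i hi
      have hw' := weight_of_add e' i hw
      rw [LinearMap.mem_ker, monomial_single_add, mul_assoc, hΨX]
      · have : mk (monomial e' 1 * s) = 0 := by
          rw [Ideal.Quotient.eq_zero_iff_mem, ← hSI]
          exact Ideal.mul_mem_left _ _ (Ideal.subset_span hs)
        rw [this]; simp
      · have h2 := (isWeightedHomogeneous_monomial (wB n m) e' (1:k) hw').mul hd'
        rw [mem_bi]
        convert h2 using 1
        rw [hw] at hdd
        have hd2 := congrArg Prod.snd hdd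
        simp only [Prod.snd_add] at hd2
        ext <;> simp <;> omega
  rw [← (hθV f hf).2, ← hΨh f hf, hΨ0, mul_zero]

lemma gen_succ {a b : ℕ} (hgen : GenInDegLE k n m I a b) : GenInDegLE k n m I (a+1) b := by
  obtain ⟨S, hSI, hS⟩ := hgen
  refine ⟨S, hSI, fun f hf => ?_⟩
  obtain ⟨d, h1, h2, h3⟩ := hS f hf
  exact ⟨d, by omega, h2, h3⟩

lemma succ_step (hI : IsBihomogeneous k n m I) {a b : ℕ} {h : BiRing k n m}
    (hgen : GenInDegLE k n m I a b) (hadm : IsAdmissibleForm k n m I a b h) :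
    IsAdmissibleForm k n m I (a+1) b h := by
  obtain ⟨hh, hHF, hz⟩ := hadm
  rw [HF_zero_iff] at hz
  have h0 := step0 I hI hh hz
  have h1 := step1 I h0
  have hz' : ∀ f ∈ biComponent k n m (a+1, b), f ∈ I ⊔ Ideal.span {h} := by
    intro f hf
    obtain ⟨g, _, hg⟩ := h1 f hf
    refine Submodule.mem_sup.mpr ⟨_, hg, h * g, ?_, by ring⟩
    exact Ideal.mem_span_singleton'.mpr ⟨g, mul_comm _ _⟩
  have h1' := step1 I (step0 I hI hh hz')
  refine ⟨hh, ?_, (HF_zero_iff _ _ _).mpr hz'⟩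
  rw [HF_eq_iff I hh h1']
  rw [HF_eq_iff I hh h1] at hHF
  exact step3 I hgen hh h0 hHF

end Adm

/-- If `(a,b)` is an admissible bidegree for `I` with admissible linear form `h`,
then `(a',b)` is also admissible for `I`, with the same admissible linear form `h`, for all
`a' ≥ a`. -/
theorem statement_1 (k : Type*) [Field k] (hk : Infinite k) (n m : ℕ)
    (I : Ideal (BiRing k n m)) (hI : IsBihomogeneous k n m I)
    (a b : ℕ) (h : BiRing k n m)
    (hgen : GenInDegLE k n m I a b) (hadm : IsAdmissibleForm k n m I a b h) :
    ∀ a' : ℕ, a ≤ a' →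
      GenInDegLE k n m I a' b ∧ IsAdmissibleForm k n m I a' b h := by
  intro a' ha
  induction a', ha using Nat.le_induction with
  | base => exact ⟨hgen, hadm⟩
  | succ c _ ih => exact ⟨Adm.gen_succ I ih.1, Adm.succ_step I hI ih.1 ih.2⟩
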